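/- arXiv:math/0701752 — 2 statements merged into one kernel-verified Lean document; each statement's English description precedes it below -/
import Mathlib

section
/- Let A be a free abelian group and φ an involution in the kernel of the natural map Aut(A) → Aut(A/2A). Then for any conjugates φ₁, φ₂ of φ in Aut(A), the product φ₁φ₂ does not have order 3. -/
/-- The subgroup `2A = {2a : a ∈ A}` of a free abelian group, as a submodule. -/
def twoA (A : Type*) [AddCommGroup A] [Module ℤ A] : Submodule ℤ A :=
  LinearMap.range ((2 : ℤ) • (LinearMap.id : A →ₗ[ℤ] A))

theorem mem_twoA_iff {A : Type*} [AddCommGroup A] [Module ℤ A] {a : A} :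
    a ∈ twoA A ↔ ∃ b : A, (2 : ℤ) • b = a :=
  Iff.rfl

/-- An element of a free abelian group divisible by every power of `2` is zero. -/
theorem eq_zero_of_forall_two_pow_smul {A : Type*} [AddCommGroup A] [Module ℤ A]
    [Module.Free ℤ A] {x : A} (h : ∀ k : ℕ, ∃ y : A, x = (2 ^ k : ℤ) • y) : x = 0 := by
  let b := Module.Free.chooseBasis ℤ A
  refine b.ext_elem fun i => ?_
  rw [map_zero, Finsupp.zero_apply]
  obtain ⟨y, hy⟩ := h (b.repr x i).natAbs
  refine Int.eq_zero_of_abs_lt_dvd (m := 2 ^ (b.repr x i).natAbs) ⟨b.repr y i, ?_⟩ ?_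
  · conv_lhs => rw [hy]
    simp
  · rw [Int.abs_eq_natAbs]
    exact_mod_cast Nat.lt_two_pow_self

/-- The kernel of `Aut A → Aut(A/2A)` is stable under conjugation. -/
theorem conj_sub_self_mem_twoA {A : Type*} [AddCommGroup A] [Module ℤ A] {φ : A ≃ₗ[ℤ] A}
    (hφ : ∀ a, φ a - a ∈ twoA A) (ρ : A ≃ₗ[ℤ] A) (a : A) :
    (ρ * φ * ρ⁻¹) a - a ∈ twoA A := by
  obtain ⟨b, hb⟩ := mem_twoA_iff.1 (hφ (ρ⁻¹ a))
  refine mem_twoA_iff.2 ⟨ρ b, ?_⟩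
  have hρ : ρ (ρ⁻¹ a) = a := ρ.apply_symm_apply a
  rw [← map_zsmul, hb, map_sub, hρ]
  rfl

/-- The kernel of `Aut A → Aut(A/2A)` has no element of order `3` when `A` is free abelian. -/
theorem eq_one_of_pow_three_eq_one {A : Type*} [AddCommGroup A] [Module ℤ A]
    [Module.Free ℤ A] {ψ : A ≃ₗ[ℤ] A} (hψ : ∀ a, ψ a - a ∈ twoA A) (h3 : ψ ^ 3 = 1) :
    ψ = 1 := by
  obtain rfl : ‹Module ℤ A› = AddCommGroup.toIntModule A := Subsingleton.elim _ _
  ext a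
  refine sub_eq_zero.1 (eq_zero_of_forall_two_pow_smul fun k => ?_)
  change ∃ y, ψ a - a = _
  have hcube : ψ (ψ (ψ a)) = a := LinearEquiv.congr_fun h3 a
  have hx : ψ (ψ (ψ a - a)) + ψ (ψ a - a) + (ψ a - a) = 0 := by
    simp only [map_sub, hcube]
    abel
  generalize ψ a - a = x at hx ⊢
  induction k with
  | zero => exact ⟨x, by simp⟩
  | succ k ih =>
    obtain ⟨y, rfl⟩ := ih
    obtain ⟨z, hz⟩ := mem_twoA_iff.1 (hψ y)
    obtain ⟨w, hw⟩ := mem_twoA_iff.1 (hψ z)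
    have hy : ψ y = y + (2 : ℤ) • z := by rw [hz]; abel
    have hz' : ψ z = z + (2 : ℤ) • w := by rw [hw]; abel
    refine ⟨-(y + (3 : ℤ) • z + (2 : ℤ) • w), ?_⟩
    simp only [map_zsmul, map_add, hy, hz'] at hx
    rw [pow_succ, ← sub_eq_zero, ← hx]
    module

/-- If an involution `φ` of a free abelian group `A` lies in the kernel of
`Aut A → Aut(A/2A)`, then the product of any two conjugates of `φ` does not have order `3`. -/
theorem stmt_15 (A : Type*) [AddCommGroup A] [Module ℤ A] [Module.Free ℤ A]
    (φ : A ≃ₗ[ℤ] A) (hinv : ∀ a, φ (φ a) = a)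
    (hker : ∀ a : A, φ a - a ∈ twoA A)
    (φ₁ φ₂ : A ≃ₗ[ℤ] A)
    (h1 : ∃ ρ : A ≃ₗ[ℤ] A, φ₁ = ρ * φ * ρ⁻¹)
    (h2 : ∃ ρ : A ≃ₗ[ℤ] A, φ₂ = ρ * φ * ρ⁻¹) :
    ¬((φ₁ * φ₂) ^ 3 = 1 ∧ φ₁ * φ₂ ≠ 1) := by
  rintro ⟨h3, hne⟩
  obtain ⟨ρ₁, rfl⟩ := h1
  obtain ⟨ρ₂, rfl⟩ := h2
  refine hne (eq_one_of_pow_three_eq_one (fun a => ?_) h3)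
  have h := add_mem (conj_sub_self_mem_twoA hker ρ₁ ((ρ₂ * φ * ρ₂⁻¹) a))
    (conj_sub_self_mem_twoA hker ρ₂ a)
  rwa [sub_add_sub_cancel] at h
end

section
/- Let A be a free abelian group (possibly of infinite rank). The natural homomorphism Aut(A) → Aut(A/2A) is surjective, and hence Aut(A)/Γ₂(A) is isomorphic to the general linear group of the ℤ/2-vector space A/2A. -/
section Lifting

variable {R K : Type*} [CommRing R] [Field K]
variable {A A' A'' V V' V'' : Type*}
  [AddCommGroup V''] [Module R V''] [Module K V'']
  [AddCommGroup V'] [Module R V'] [Module K V']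
  [AddCommGroup V] [Module R V] [Module K V]
  [AddCommGroup A''] [Module R A''] [AddCommGroup A'] [Module R A'] [AddCommGroup A] [Module R A]

/-- The `K`-linear isomorphism `g` is induced by an `R`-linear isomorphism along `π` and `π'`. -/
def LiftsAlong (π : A →ₗ[R] V) (π' : A' →ₗ[R] V') (g : V ≃ₗ[K] V') : Prop :=
  ∃ G : A ≃ₗ[R] A', ∀ a, π' (G a) = g (π a)

namespace LiftsAlong

variable {π : A →ₗ[R] V} {π' : A' →ₗ[R] V'} {π'' : A'' →ₗ[R] V''}

theorem refl (π : A →ₗ[R] V) : LiftsAlong π π (LinearEquiv.refl K V) :=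
  ⟨LinearEquiv.refl R A, fun _ => rfl⟩

theorem neg (π : A →ₗ[R] V) : LiftsAlong π π (LinearEquiv.neg K : V ≃ₗ[K] V) :=
  ⟨LinearEquiv.neg R, fun a => by simp⟩

theorem symm {g : V ≃ₗ[K] V'} (h : LiftsAlong π π' g) : LiftsAlong π' π g.symm := by
  obtain ⟨G, hG⟩ := h
  refine ⟨G.symm, fun a => ?_⟩
  rw [LinearEquiv.eq_symm_apply, ← hG, LinearEquiv.apply_symm_apply]

theorem trans {g : V ≃ₗ[K] V'} {g' : V' ≃ₗ[K] V''} (h : LiftsAlong π π' g)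
    (h' : LiftsAlong π' π'' g') : LiftsAlong π π'' (g.trans g') := by
  obtain ⟨G, hG⟩ := h
  obtain ⟨G', hG'⟩ := h'
  exact ⟨G.trans G', fun a => by simp [hG, hG']⟩

theorem prodComm (π : A →ₗ[R] V) (π' : A' →ₗ[R] V') :
    LiftsAlong (π.prodMap π') (π'.prodMap π) (LinearEquiv.prodComm K V V') :=
  ⟨LinearEquiv.prodComm R A A', fun _ => rfl⟩

theorem prodAssoc (π : A →ₗ[R] V) (π' : A' →ₗ[R] V') (π'' : A'' →ₗ[R] V'') :
    LiftsAlong ((π.prodMap π').prodMap π'') (π.prodMap (π'.prodMap π''))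
      (LinearEquiv.prodAssoc K V V' V'') :=
  ⟨LinearEquiv.prodAssoc R A A' A'', fun _ => rfl⟩

theorem prodCongr {B B' U U' : Type*} [AddCommGroup B] [Module R B] [AddCommGroup B'] [Module R B']
    [AddCommGroup U] [Module R U] [Module K U] [AddCommGroup U'] [Module R U'] [Module K U']
    {ρ : B →ₗ[R] U} {ρ' : B' →ₗ[R] U'} {g : V ≃ₗ[K] V'} {k : U ≃ₗ[K] U'}
    (hg : LiftsAlong π π' g) (hk : LiftsAlong ρ ρ' k) :
    LiftsAlong (π.prodMap ρ) (π'.prodMap ρ') (g.prodCongr k) := by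
  obtain ⟨G, hG⟩ := hg
  obtain ⟨H, hH⟩ := hk
  exact ⟨G.prodCongr H, fun a => by simp [hG, hH]⟩

theorem domLCongr {ι κ : Type*} (e : ι ≃ κ) (π : A →ₗ[R] V) :
    LiftsAlong (Finsupp.mapRange.linearMap (α := ι) π) (Finsupp.mapRange.linearMap π)
      (Finsupp.domLCongr e : _ ≃ₗ[K] _) :=
  ⟨Finsupp.domLCongr e, fun a => by ext; simp⟩

theorem sumFinsupp (ι κ : Type*) (π : A →ₗ[R] V) :
    LiftsAlong (Finsupp.mapRange.linearMap (α := ι ⊕ κ) π)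
      ((Finsupp.mapRange.linearMap π).prodMap (Finsupp.mapRange.linearMap π))
      (Finsupp.sumFinsuppLEquivProdFinsupp K) :=
  ⟨Finsupp.sumFinsuppLEquivProdFinsupp R, fun a => by
    ext <;> simp⟩

theorem curry (ι κ : Type*) (π : A →ₗ[R] V) :
    LiftsAlong (Finsupp.mapRange.linearMap (α := ι × κ) π)
      (Finsupp.mapRange.linearMap (Finsupp.mapRange.linearMap π))
      (Finsupp.curryLinearEquiv K) :=
  ⟨Finsupp.curryLinearEquiv R, fun a => by ext; simp⟩

end LiftsAlong

/-- A sequence is its first term together with the remaining ones. -/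
noncomputable def finsuppNatUncons (S M : Type*) [Semiring S] [AddCommMonoid M] [Module S M] :
    (ℕ →₀ M) ≃ₗ[S] M × (ℕ →₀ M) where
  toFun f := (f 0, f.comapDomain Nat.succ Nat.succ_injective.injOn)
  map_add' f g := by ext <;> simp
  map_smul' c f := by ext <;> simp
  invFun p := Finsupp.single 0 p.1 + p.2.mapDomain Nat.succ
  left_inv f := by
    ext n
    cases n with
    | zero => simp [Finsupp.mapDomain_of_notMem_range]
    | succ n => simp [← Nat.succ_eq_add_one, Finsupp.mapDomain_apply Nat.succ_injective]
  right_inv p := by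
    ext n
    · simp [Finsupp.mapDomain_of_notMem_range]
    · simp [Finsupp.mapDomain_apply Nat.succ_injective]

@[simp]
theorem finsuppNatUncons_fst {S M : Type*} [Semiring S] [AddCommMonoid M] [Module S M]
    (f : ℕ →₀ M) : (finsuppNatUncons S M f).1 = f 0 := rfl

@[simp]
theorem finsuppNatUncons_snd_apply {S M : Type*} [Semiring S] [AddCommMonoid M] [Module S M]
    (f : ℕ →₀ M) (n : ℕ) : (finsuppNatUncons S M f).2 n = f (n + 1) := rfl

namespace LiftsAlong

variable {π : A →ₗ[R] V} {π' : A' →ₗ[R] V'}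

theorem natUncons (π : A →ₗ[R] V) :
    LiftsAlong (Finsupp.mapRange.linearMap (α := ℕ) π)
      (π.prodMap (Finsupp.mapRange.linearMap π)) (finsuppNatUncons K V) :=
  ⟨finsuppNatUncons R A, fun a => by ext <;> simp⟩

variable [Algebra R K] [IsScalarTower R K V'] [IsScalarTower R K V]

/-- Lower triangular shears lift. -/
theorem skewProd [Module.Projective R A] (π : A →ₗ[R] V) (hπ' : Function.Surjective π')
    (x : V →ₗ[K] V') :
    LiftsAlong (π.prodMap π') (π.prodMap π')
      ((LinearEquiv.refl K V).skewProd (LinearEquiv.refl K V') x) := by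
  obtain ⟨X, hX⟩ := Module.projective_lifting_property π' (x.restrictScalars R ∘ₗ π) hπ'
  refine ⟨(LinearEquiv.refl R A).skewProd (LinearEquiv.refl R A') X, fun a => ?_⟩
  have : π' (X a.1) = x (π a.1) := LinearMap.congr_fun hX a.1
  simp [LinearEquiv.skewProd_apply, this]

/-- Upper triangular shears lift. -/
theorem exists_shear [Module.Projective R A'] (hπ : Function.Surjective π) (π' : A' →ₗ[R] V')
    (x : V' →ₗ[K] V) :
    ∃ e : (V × V') ≃ₗ[K] (V × V'), LiftsAlong (π.prodMap π') (π.prodMap π') e ∧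
      ∀ p, e p = (p.1 + x p.2, p.2) :=
  ⟨_, ((prodComm π π').trans (skewProd π' hπ x)).trans (prodComm π' π),
    fun p => by simp [LinearEquiv.skewProd_apply]⟩

/-- Whitehead's lemma: `diag(u, u⁻¹)` is a product of liftable maps. -/
theorem prodCongr_symm [Module.Projective R A] (hπ : Function.Surjective π) (u : V ≃ₗ[K] V) :
    LiftsAlong (π.prodMap π) (π.prodMap π) (u.prodCongr u.symm) := by
  obtain ⟨e, he, hep⟩ := exists_shear hπ π (-u.symm.toLinearMap)
  have h := ((((skewProd π hπ u.toLinearMap).trans he).trans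
    (skewProd π hπ u.toLinearMap)).trans (prodComm π π)).trans ((refl π).prodCongr (neg π) (K := K))
  convert h using 1
  ext p <;> simp [LinearEquiv.skewProd_apply, hep]

/-- An Eilenberg swindle: any automorphism lifts after adding infinitely many copies of the
identity. -/
theorem prodCongr_refl_finsupp [Module.Free R A] (hπ : Function.Surjective π)
    (u : V ≃ₗ[K] V) :
    LiftsAlong
      (π.prodMap ((Finsupp.mapRange.linearMap (α := ℕ) π).prodMap
        (Finsupp.mapRange.linearMap (α := ℕ) π)))
      (π.prodMap ((Finsupp.mapRange.linearMap π).prodMap (Finsupp.mapRange.linearMap π)))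
      (u.prodCongr (LinearEquiv.refl K ((ℕ →₀ V) × (ℕ →₀ V)))) := by
  set ρ : (ℕ →₀ A) →ₗ[R] (ℕ →₀ V) := Finsupp.mapRange.linearMap π with hρ
  have hρs : Function.Surjective ρ := Finsupp.mapRange_surjective π (map_zero π) hπ
  set D : (ℕ →₀ V) ≃ₗ[K] (ℕ →₀ V) := Finsupp.mapRange.linearEquiv u with hD
  have hW : LiftsAlong (ρ.prodMap ρ) (ρ.prodMap ρ) (D.prodCongr D.symm) := prodCongr_symm hρs D
  have hT := ((natUncons (K := K) π).prodCongr (refl (K := K) ρ)).trans (prodAssoc π ρ ρ)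
  set T := ((finsuppNatUncons K V).prodCongr (LinearEquiv.refl K (ℕ →₀ V))).trans
    (LinearEquiv.prodAssoc K V (ℕ →₀ V) (ℕ →₀ V)) with hTdef
  have h := (((refl (K := K) π).prodCongr hW).symm.trans hT.symm).trans (hW.trans hT)
  convert h using 1
  refine LinearEquiv.ext fun p => ?_
  obtain ⟨q, rfl⟩ := (T.trans ((LinearEquiv.refl K V).prodCongr (D.prodCongr D.symm))).surjective p
  simp only [LinearEquiv.trans_apply, LinearEquiv.symm_apply_apply]
  ext <;> simp [hTdef, hD]

/-- If every `diag(u, 1)` lifts, then so does every automorphism of `V × V` whose lower left block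
is injective. -/
theorem of_injective_snd_inl [Module.Projective R A] (hπ : Function.Surjective π)
    (hu : ∀ u : V ≃ₗ[K] V,
      LiftsAlong (π.prodMap π) (π.prodMap π) (u.prodCongr (LinearEquiv.refl K V)))
    (g : (V × V) ≃ₗ[K] (V × V)) (hg : Function.Injective fun v => (g (v, 0)).2) :
    LiftsAlong (π.prodMap π) (π.prodMap π) g := by
  set a : V →ₗ[K] V := LinearMap.fst K V V ∘ₗ g.toLinearMap ∘ₗ LinearMap.inl K V V with ha
  set c : V →ₗ[K] V := LinearMap.snd K V V ∘ₗ g.toLinearMap ∘ₗ LinearMap.inl K V V with hc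
  obtain ⟨l, hl⟩ := c.exists_leftInverse_of_injective (LinearMap.ker_eq_bot.2 hg)
  have hl' : ∀ v, l (c v) = v := LinearMap.congr_fun hl
  obtain ⟨e, he, hep⟩ := exists_shear hπ π ((LinearMap.id - a) ∘ₗ l)
  have hs := skewProd π hπ (-c)
  set s := (LinearEquiv.refl K V).skewProd (LinearEquiv.refl K V) (-c) with hsdef
  set k := (g.trans e).trans s with hk
  have hgv : ∀ v, g (v, 0) = (a v, c v) := fun v => rfl
  have hk0 : ∀ v, k (v, 0) = (v, 0) := fun v => by
    simp [hk, hsdef, LinearEquiv.skewProd_apply, hep, hgv, hl']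
  set x : V →ₗ[K] V := LinearMap.fst K V V ∘ₗ k.toLinearMap ∘ₗ LinearMap.inr K V V with hx
  set d : V →ₗ[K] V := LinearMap.snd K V V ∘ₗ k.toLinearMap ∘ₗ LinearMap.inr K V V with hd
  have hkp : ∀ v w, k (v, w) = (v + x w, d w) := fun v w => by
    have h : ((v, w) : V × V) = (v, 0) + (0, w) := by simp
    rw [h, map_add, hk0]
    ext <;> simp [hx, hd]
  have hdi : Function.Injective d := by
    refine (injective_iff_map_eq_zero d).2 fun w hw => ?_
    have h : k (0, w) = k (x w, 0) := by simp [hkp, hw]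
    simpa using congrArg Prod.snd (k.injective h)
  have hds : Function.Surjective d := fun w => by
    obtain ⟨⟨v, z⟩, hz⟩ := k.surjective (0, w)
    rw [hkp] at hz
    exact ⟨z, congrArg Prod.snd hz⟩
  set u := LinearEquiv.ofBijective d ⟨hdi, hds⟩ with hudef
  obtain ⟨f, hf, hfp⟩ := exists_shear hπ π (x ∘ₗ u.symm.toLinearMap)
  have h1 := (((prodComm (K := K) π π).trans (hu u)).trans (prodComm π π)).trans hf
  have h2 := (h1.trans hs.symm).trans he.symm
  convert h2 using 1
  refine LinearEquiv.ext fun p => ?_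
  have hkf : k p = f (p.1, d p.2) := by
    have hud : ∀ w, u.symm (d w) = w := u.symm_apply_apply
    simp [hfp, hud, ← hkp]
  have : s (e (g p)) = f (p.1, d p.2) := hkf
  simp only [LinearEquiv.trans_apply, LinearEquiv.eq_symm_apply, this]
  rfl

end LiftsAlong

/-- The coordinatewise reduction of the free module on `ι`. -/
noncomputable def coordReduction (R K ι : Type*) [CommRing R] [Field K] [Algebra R K] :
    (ι →₀ R) →ₗ[R] (ι →₀ K) :=
  Finsupp.mapRange.linearMap (Algebra.linearMap R K)

theorem coordReduction_surjective {R K : Type*} (ι : Type*) [CommRing R] [Field K] [Algebra R K]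
    (h : Function.Surjective (algebraMap R K)) : Function.Surjective (coordReduction R K ι) :=
  Finsupp.mapRange_surjective _ (map_zero _) h

theorem nonempty_equiv_sum_self (ι : Type*) [Infinite ι] : Nonempty (ι ≃ ι ⊕ ι) := by
  rw [← Cardinal.eq, Cardinal.mk_sum, Cardinal.lift_id,
    Cardinal.add_eq_self (Cardinal.aleph0_le_mk ι)]

theorem nonempty_equiv_nat_prod_self (ι : Type*) [Infinite ι] : Nonempty (ι ≃ ℕ × ι) := by
  rw [← Cardinal.lift_mk_eq', Cardinal.mk_prod]
  simp

/-- An injection of one half of an infinite set, avoiding the image of the other half, extends to a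
permutation. -/
theorem exists_perm_extending_inl {ι : Type*} [Infinite ι] (f : ι ⊕ ι → ι ⊕ ι)
    (hf : Function.Injective f) : ∃ p : Equiv.Perm (ι ⊕ ι), ∀ i, p (Sum.inl i) = f (Sum.inl i) := by
  classical
  have hl : Function.Injective (f ∘ Sum.inl) := hf.comp Sum.inl_injective
  have hc : Nonempty (ι ≃ ((Set.range (f ∘ Sum.inl))ᶜ : Set (ι ⊕ ι))) := by
    rw [← Cardinal.eq]
    refine le_antisymm ?_ ?_
    · refine Cardinal.mk_le_of_injective (f := fun i => ⟨f (Sum.inr i), ?_⟩) fun i j h => ?_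
      · rintro ⟨j, hj⟩
        exact Sum.inl_ne_inr (hf hj)
      · exact Sum.inr_injective (hf (congrArg Subtype.val h))
    · refine (Cardinal.mk_set_le _).trans ?_
      rw [Cardinal.mk_sum, Cardinal.lift_id, Cardinal.add_eq_self (Cardinal.aleph0_le_mk ι)]
  obtain ⟨c⟩ := hc
  exact ⟨((Equiv.ofInjective _ hl).sumCongr c).trans (Equiv.Set.sumCompl _), fun i => by simp⟩

namespace LiftsAlong

theorem prodCongr_refl_coordReduction [Algebra R K] (hRK : Function.Surjective (algebraMap R K))
    {ι : Type*} [Infinite ι] (u : (ι →₀ K) ≃ₗ[K] (ι →₀ K)) :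
    LiftsAlong ((coordReduction R K ι).prodMap (coordReduction R K ι))
      ((coordReduction R K ι).prodMap (coordReduction R K ι))
      (u.prodCongr (LinearEquiv.refl K (ι →₀ K))) := by
  obtain ⟨e₁⟩ := nonempty_equiv_sum_self ι
  obtain ⟨e₂⟩ := nonempty_equiv_nat_prod_self ι
  set ρ : (ℕ →₀ ι →₀ R) →ₗ[R] (ℕ →₀ ι →₀ K) :=
    Finsupp.mapRange.linearMap (coordReduction R K ι)
  let k : (ι →₀ K) ≃ₗ[K] (ℕ →₀ ι →₀ K) × (ℕ →₀ ι →₀ K) :=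
    ((Finsupp.domLCongr (e₁.trans (e₂.sumCongr e₂))).trans
      (Finsupp.sumFinsuppLEquivProdFinsupp K)).trans
      ((Finsupp.curryLinearEquiv K).prodCongr (Finsupp.curryLinearEquiv K))
  have hk : LiftsAlong (K := K) (A' := (ℕ →₀ ι →₀ R) × (ℕ →₀ ι →₀ R))
      (V' := (ℕ →₀ ι →₀ K) × (ℕ →₀ ι →₀ K)) (coordReduction R K ι) (ρ.prodMap ρ) k :=
    ((domLCongr (e₁.trans (e₂.sumCongr e₂)) (Algebra.linearMap R K)).trans
      (sumFinsupp (ℕ × ι) (ℕ × ι) (Algebra.linearMap R K))).trans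
      ((curry ℕ ι (Algebra.linearMap R K)).prodCongr (curry ℕ ι (Algebra.linearMap R K)))
  have hr := refl (K := K) (coordReduction R K ι)
  have h := ((hr.prodCongr hk).trans
    (prodCongr_refl_finsupp (coordReduction_surjective ι hRK) u)).trans (hr.prodCongr hk).symm
  have hu : u.prodCongr (LinearEquiv.refl K (ι →₀ K)) =
      (((LinearEquiv.refl K _).prodCongr k).trans (u.prodCongr (LinearEquiv.refl K _))).trans
        ((LinearEquiv.refl K _).prodCongr k).symm :=
    LinearEquiv.ext fun p => by
      rw [LinearEquiv.trans_apply, LinearEquiv.eq_symm_apply]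
      rfl
  rw [hu]
  exact h

/-- Automorphisms of vector spaces of infinite dimension lift. -/
theorem coordReduction_of_infinite [Algebra R K] (hRK : Function.Surjective (algebraMap R K))
    {ι : Type*} [Infinite ι] (g : (ι →₀ K) ≃ₗ[K] (ι →₀ K)) :
    LiftsAlong (coordReduction R K ι) (coordReduction R K ι) g := by
  obtain ⟨e⟩ := nonempty_equiv_sum_self ι
  have hS := sumFinsupp (K := K) ι ι (Algebra.linearMap R K)
  have hE := (domLCongr (K := K) e (Algebra.linearMap R K)).trans hS
  set S : (ι ⊕ ι →₀ K) ≃ₗ[K] (ι →₀ K) × (ι →₀ K) := Finsupp.sumFinsuppLEquivProdFinsupp K with hSdef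
  set E := (Finsupp.domLCongr e : (ι →₀ K) ≃ₗ[K] _).trans S
  set φ := (E.symm.trans g).trans E with hφ
  let v : ι ⊕ ι → (ι →₀ K) := fun j => (φ (S (Finsupp.single j 1))).2
  have hv : Submodule.span K (Set.range v) = ⊤ := by
    set q := LinearMap.snd K (ι →₀ K) (ι →₀ K) ∘ₗ φ.toLinearMap ∘ₗ S.toLinearMap with hq
    have hqs : Function.Surjective q :=
      Prod.snd_surjective.comp (φ.surjective.comp S.surjective)
    have : Set.range v = q '' Set.range (Finsupp.basisSingleOne (R := K) (ι := ι ⊕ ι)) := by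
      rw [← Set.range_comp]
      exact congrArg Set.range (funext fun j => by simp [v, hq])
    rw [this, Submodule.span_image, Module.Basis.span_eq, Submodule.map_top,
      LinearMap.range_eq_top.2 hqs]
  obtain ⟨κ, a, ha, hspan, hli⟩ := exists_linearIndependent' K v
  have B : Module.Basis κ K (ι →₀ K) := Module.Basis.mk hli (by rw [hspan, hv])
  let b : ι ≃ κ := (Finsupp.basisSingleOne (R := K) (ι := ι)).indexEquiv B
  obtain ⟨p, hp⟩ := exists_perm_extending_inl (fun j => a (b (e.symm j)))
    (ha.comp (b.injective.comp e.symm.injective))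
  have hP := (hS.symm.trans (domLCongr (K := K) p (Algebra.linearMap R K))).trans hS
  set P := (S.symm.trans (Finsupp.domLCongr p)).trans S with hPdef
  have hψ := of_injective_snd_inl (coordReduction_surjective ι hRK)
    (prodCongr_refl_coordReduction hRK) (P.trans φ) (by
      have hlin : Function.Injective
          (Finsupp.linearCombination K fun i => v (a (b (e.symm (Sum.inl i))))) :=
        hli.comp (fun i => b (e.symm (Sum.inl i)))
          (b.injective.comp (e.symm.injective.comp Sum.inl_injective))
      have : (LinearMap.snd K (ι →₀ K) (ι →₀ K) ∘ₗ (P.trans φ).toLinearMap ∘ₗ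
          LinearMap.inl K (ι →₀ K) (ι →₀ K)) =
          Finsupp.linearCombination K fun i => v (a (b (e.symm (Sum.inl i)))) := by
        refine Finsupp.lhom_ext' fun i => LinearMap.ext_ring ?_
        have hsi : S.symm (Finsupp.single i 1, 0) = Finsupp.single (Sum.inl i) 1 := by
          rw [LinearEquiv.symm_apply_eq]
          ext j
          · simp [hSdef]
          · simp [hSdef]
        simp [hPdef, hsi, hp, v]
      rw [← this] at hlin
      exact hlin)
  have h := (hE.trans (hP.symm.trans hψ)).trans hE.symm
  have hg : g = (E.trans (P.symm.trans (P.trans φ))).trans E.symm :=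
    LinearEquiv.ext fun x => by simp [hφ]
  rw [hg]
  exact h

end LiftsAlong

end Lifting

/-- Every invertible matrix over `ZMod 2` is the reduction of an invertible integral matrix. -/
theorem exists_int_matrix_lift {n : Type*} [Fintype n] [DecidableEq n] (M : Matrix n n (ZMod 2))
    (hM : M.det ≠ 0) : ∃ N : Matrix n n ℤ, IsUnit N.det ∧ N.map (Int.cast : ℤ → ZMod 2) = M := by
  refine Matrix.diagonal_transvection_induction_of_det_ne_zero
    (fun M => ∃ N : Matrix n n ℤ, IsUnit N.det ∧ N.map (Int.cast : ℤ → ZMod 2) = M) M hM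
    (fun D hD => ?_) (fun t => ?_) fun A B hA hB ihA ihB => ?_
  · refine ⟨1, by simp, ?_⟩
    have hD' : ∀ i, D i = 1 := fun i => by
      have h0 : D i ≠ 0 := by
        rw [Matrix.det_diagonal, Finset.prod_ne_zero_iff] at hD
        exact hD i (Finset.mem_univ i)
      exact (by decide : ∀ x : ZMod 2, x ≠ 0 → x = 1) _ h0
    ext i j
    simp [Matrix.diagonal_apply, Matrix.one_apply, hD']
  · obtain ⟨c, hc⟩ := ZMod.intCast_surjective t.c
    refine ⟨Matrix.transvection t.i t.j c, by simp [Matrix.det_transvection_of_ne _ _ t.hij], ?_⟩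
    ext i j
    simp [Matrix.TransvectionStruct.toMatrix, Matrix.transvection, Matrix.one_apply,
      Matrix.single_apply, ← hc]
  · obtain ⟨N, hN, rfl⟩ := ihA
    obtain ⟨N', hN', rfl⟩ := ihB
    exact ⟨N * N', by simpa using ⟨hN, hN'⟩, Matrix.map_mul (f := Int.castRingHom (ZMod 2))⟩

theorem LiftsAlong.coordReduction_of_finite {ι : Type*} [Finite ι]
    (g : (ι →₀ ZMod 2) ≃ₗ[ZMod 2] (ι →₀ ZMod 2)) :
    LiftsAlong (coordReduction ℤ (ZMod 2) ι) (coordReduction ℤ (ZMod 2) ι) g := by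
  classical
  have := Fintype.ofFinite ι
  let b := Finsupp.basisSingleOne (R := ZMod 2) (ι := ι)
  let c := Finsupp.basisSingleOne (R := ℤ) (ι := ι)
  obtain ⟨N, hN, hNg⟩ := exists_int_matrix_lift (LinearMap.toMatrix b b g.toLinearMap)
    (LinearEquiv.isUnit_det g b b).ne_zero
  refine ⟨Matrix.toLinearEquiv c N hN, fun a => ?_⟩
  suffices h : coordReduction ℤ (ZMod 2) ι ∘ₗ (Matrix.toLinearEquiv c N hN).toLinearMap =
      g.toLinearMap.restrictScalars ℤ ∘ₗ coordReduction ℤ (ZMod 2) ι from LinearMap.congr_fun h a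
  refine c.ext fun i => Finsupp.ext fun j => ?_
  have h := congrFun (congrFun hNg j) i
  have hc : (Matrix.toLin Finsupp.basisSingleOne Finsupp.basisSingleOne N)
      (Finsupp.single i 1) j = N j i := by
    simpa [c, Finsupp.single_apply] using DFunLike.congr_fun (Matrix.toLin_self c c N i) j
  simpa [LinearMap.toMatrix_apply, b, c, coordReduction, hc] using h

/-- Automorphisms of `ZMod 2`-vector spaces lift to automorphisms of free abelian groups. -/
theorem LiftsAlong.coordReduction_int {ι : Type*} (g : (ι →₀ ZMod 2) ≃ₗ[ZMod 2] (ι →₀ ZMod 2)) :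
    LiftsAlong (coordReduction ℤ (ZMod 2) ι) (coordReduction ℤ (ZMod 2) ι) g := by
  cases finite_or_infinite ι
  · exact coordReduction_of_finite g
  · exact coordReduction_of_infinite ZMod.intCast_surjective g

theorem mem_twoA {A : Type*} [AddCommGroup A] [Module ℤ A] {a : A} :
    a ∈ twoA A ↔ ∃ b : A, b + b = a := by
  simp [twoA, two_smul]

theorem map_twoA {A A' : Type*} [AddCommGroup A] [Module ℤ A] [AddCommGroup A'] [Module ℤ A']
    (σ : A ≃ₗ[ℤ] A') : (twoA A).map (σ : A →ₗ[ℤ] A') = twoA A' := by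
  ext a
  simp only [Submodule.mem_map, mem_twoA]
  constructor
  · rintro ⟨_, ⟨b, rfl⟩, rfl⟩
    exact ⟨σ b, (map_add σ _ _).symm⟩
  · rintro ⟨b, rfl⟩
    exact ⟨σ.symm b + σ.symm b, ⟨_, rfl⟩, by simp⟩

theorem ker_coordReduction_int (ι : Type*) :
    LinearMap.ker (coordReduction ℤ (ZMod 2) ι) = twoA (ι →₀ ℤ) := by
  ext a
  rw [LinearMap.mem_ker, mem_twoA]
  constructor
  · intro h
    have h2 : ∀ i, (2 : ℤ) ∣ a i := fun i =>
      (ZMod.intCast_zmod_eq_zero_iff_dvd (a i) 2).1 (DFunLike.congr_fun h i)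
    refine ⟨a.mapRange (· / 2) (by simp), Finsupp.ext fun i => ?_⟩
    simpa [two_mul] using Int.mul_ediv_cancel' (h2 i)
  · rintro ⟨b, rfl⟩
    ext i
    simp [coordReduction, CharTwo.add_self_eq_zero]

/-- The first isomorphism theorem for modules, as an additive equivalence. -/
noncomputable def quotientAddEquiv {S M N : Type*} [Ring S] [AddCommGroup M] [AddCommGroup N]
    [Module S M] [Module S N] (p : Submodule S M) (π : M →ₗ[S] N) (hp : p = LinearMap.ker π)
    (hπ : Function.Surjective π) : (M ⧸ p) ≃+ N :=
  ((Submodule.quotEquivOfEq _ _ hp).trans (π.quotKerEquivOfSurjective hπ)).toAddEquiv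

/-- The additive equivalence of quotients induced by an automorphism preserving a submodule. -/
def quotientMapAddEquiv {S M : Type*} [Ring S] [AddCommGroup M] [Module S M] (p : Submodule S M)
    (σ : M ≃ₗ[S] M) (hσ : p.map (σ : M →ₗ[S] M) = p) : (M ⧸ p) ≃+ (M ⧸ p) :=
  (Submodule.Quotient.equiv p p σ hσ).toAddEquiv

/-- Every automorphism of `A / 2A` is induced by an automorphism of the free abelian group `A`. -/
theorem exists_lift_quotient_twoA {A : Type*} [AddCommGroup A] [Module ℤ A] [Module.Free ℤ A]
    (g : (A ⧸ twoA A) ≃+ (A ⧸ twoA A)) :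
    ∃ σ : A ≃ₗ[ℤ] A, ∀ a : A,
      g (Submodule.Quotient.mk a) = Submodule.Quotient.mk (σ a) := by
  let r := (Module.Free.chooseBasis ℤ A).repr
  let π := coordReduction ℤ (ZMod 2) (Module.Free.ChooseBasisIndex ℤ A) ∘ₗ r.toLinearMap
  have hker : twoA A = LinearMap.ker π := by
    rw [LinearMap.ker_comp, ker_coordReduction_int, ← map_twoA r]
    exact (Submodule.comap_map_eq_of_injective r.injective _).symm
  have hπ : Function.Surjective π :=
    (coordReduction_surjective _ ZMod.intCast_surjective).comp r.surjective
  let q : (A ⧸ twoA A) ≃+ (Module.Free.ChooseBasisIndex ℤ A →₀ ZMod 2) :=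
    quotientAddEquiv (twoA A) π hker hπ
  have hq : ∀ a, q (Submodule.Quotient.mk a) = π a := fun a => rfl
  let k := (q.symm.trans g).trans q
  obtain ⟨G, hG⟩ := LiftsAlong.coordReduction_int
    (k.toLinearEquiv fun c x => ZMod.map_smul k.toAddMonoidHom c x)
  refine ⟨(r.trans G).trans r.symm, fun a => q.injective ?_⟩
  have h : coordReduction ℤ (ZMod 2) _ (G (r a)) = k (π a) := hG (r a)
  have hk : k (π a) = q (g (Submodule.Quotient.mk a)) := by
    rw [← hq]
    exact congrArg (fun x => q (g x)) (q.symm_apply_apply _)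
  rw [hq, ← hk, ← h]
  exact congrArg _ (r.apply_symm_apply _).symm

/-- For a free abelian group `A`, the natural homomorphism `Aut A → Aut(A/2A)` is surjective,
its kernel is `Γ₂(A)`, and hence `Aut A / Γ₂(A)` is isomorphic to the general linear group of
the vector space `A/2A`. -/
theorem stmt_17 (A : Type*) [AddCommGroup A] [Module ℤ A] [Module.Free ℤ A] :
    ∃ f : (A ≃ₗ[ℤ] A) →* ((A ⧸ twoA A) ≃ₗ[ℤ] (A ⧸ twoA A)),
      (∀ (σ : A ≃ₗ[ℤ] A) (a : A),
        f σ (Submodule.Quotient.mk a) = Submodule.Quotient.mk (σ a)) ∧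
      Function.Surjective f ∧
      (∀ σ : A ≃ₗ[ℤ] A, σ ∈ f.ker ↔ ∀ a : A, σ a - a ∈ twoA A) ∧
      Nonempty (((A ≃ₗ[ℤ] A) ⧸ f.ker) ≃* ((A ⧸ twoA A) ≃ₗ[ℤ] (A ⧸ twoA A))) := by
  obtain ⟨f, hf⟩ : ∃ f : (A ≃ₗ[ℤ] A) →* ((A ⧸ twoA A) ≃ₗ[ℤ] (A ⧸ twoA A)),
      ∀ (σ : A ≃ₗ[ℤ] A) (a : A),
        f σ (Submodule.Quotient.mk a) = Submodule.Quotient.mk (σ a) :=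
    ⟨{  toFun := fun σ => (quotientMapAddEquiv (twoA A) σ (map_twoA σ)).toIntLinearEquiv
        map_one' := LinearEquiv.ext fun x => by
          obtain ⟨a, rfl⟩ := Submodule.Quotient.mk_surjective _ x
          rfl
        map_mul' := fun σ τ => LinearEquiv.ext fun x => by
          obtain ⟨a, rfl⟩ := Submodule.Quotient.mk_surjective _ x
          rfl }, fun σ a => rfl⟩
  have hs : Function.Surjective f := fun g => by
    obtain ⟨σ, hσ⟩ := exists_lift_quotient_twoA g.toAddEquiv
    refine ⟨σ, LinearEquiv.ext fun x => ?_⟩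
    obtain ⟨a, rfl⟩ := Submodule.Quotient.mk_surjective _ x
    rw [hf, ← hσ]
    rfl
  refine ⟨f, hf, hs, fun σ => ?_, ⟨QuotientGroup.quotientKerEquivOfSurjective f hs⟩⟩
  rw [MonoidHom.mem_ker]
  refine ⟨fun h a => ?_, fun h => LinearEquiv.ext fun x => ?_⟩
  · rw [← Submodule.Quotient.eq, ← hf, h]
    rfl
  · obtain ⟨a, rfl⟩ := Submodule.Quotient.mk_surjective _ x
    rw [hf, (Submodule.Quotient.eq _).2 (h a)]
    rfl
end
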